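/- arXiv:2306.02943 — 2 statements merged into one kernel-verified Lean document; each statement's English description precedes it below -/
import Mathlib

section
/- Let A, B, C be jointly distributed discrete random variables taking finitely many values in a field (or a ring with no zero divisors), and assume A never takes the value 0. Then H(A(B − C)) + H(A, B, C) ≤ H(A, B − C) + H(AB, AC). If A, B, C are i.i.d., then H(A(B − C)) ≤ 2 H(AB) + H(A − B) − 2 H(A). -/
/-- The probability of the event `E` under the probability mass function `p`
on a finite sample space. -/
noncomputable def prob {Ω : Type*} [Fintype Ω] (p : Ω → ℝ) (E : Set Ω) : ℝ :=
  ∑ ω, E.indicator p ω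

/-- The Shannon entropy (base 2) of the discrete random variable `X` on the finite
probability space given by the probability mass function `p`. -/
noncomputable def ent {Ω S : Type*} [Fintype Ω] (p : Ω → ℝ) (X : Ω → S) : ℝ :=
  letI := Classical.decEq S
  ∑ v ∈ Finset.univ.image X,
      -(prob p {ω | X ω = v} * Real.logb 2 (prob p {ω | X ω = v}))

open Classical in
/-- Probability of the fibre of `X` through `ω`. -/
noncomputable def fibP {Ω S : Type*} [Fintype Ω] (p : Ω → ℝ) (X : Ω → S) (ω : Ω) : ℝ :=
  ∑ ω', if X ω' = X ω then p ω' else 0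

open Classical in
theorem prob_eq_ite {Ω : Type*} [Fintype Ω] (p : Ω → ℝ) (E : Set Ω) :
    prob p E = ∑ ω, if ω ∈ E then p ω else 0 := by
  unfold prob
  refine Finset.sum_congr rfl fun ω _ => ?_
  rw [Set.indicator_apply]

theorem fibP_eq {Ω S : Type*} [Fintype Ω] (p : Ω → ℝ) (X : Ω → S) (ω : Ω) :
    fibP p X ω = prob p {ω' | X ω' = X ω} := by
  rw [prob_eq_ite]; rfl

open Classical in
theorem ent_eq_of_subset {Ω S : Type*} [Fintype Ω] (p : Ω → ℝ) (X : Ω → S) (s : Finset S)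
    (hs : Finset.univ.image X ⊆ s) :
    ent p X = ∑ v ∈ s, -(prob p {ω | X ω = v} * Real.logb 2 (prob p {ω | X ω = v})) := by
  unfold ent
  refine Finset.sum_subset hs fun v _ hv => ?_
  have : prob p {ω | X ω = v} = 0 := by
    rw [prob_eq_ite]
    refine Finset.sum_eq_zero fun ω _ => ?_
    rw [if_neg]
    intro h
    exact hv (Finset.mem_image.2 ⟨ω, Finset.mem_univ _, h⟩)
  simp [this]

open Classical in
theorem ent_eq_fib {Ω S : Type*} [Fintype Ω] (p : Ω → ℝ) (X : Ω → S) :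
    ent p X = -∑ ω, p ω * Real.logb 2 (fibP p X ω) := by
  rw [ent_eq_of_subset p X _ (Finset.Subset.refl _), Finset.sum_neg_distrib, neg_inj]
  rw [← Finset.sum_fiberwise_of_maps_to (s := Finset.univ) (t := Finset.univ.image X) (g := X)
    (fun ω hω => Finset.mem_image_of_mem X hω)]
  refine Finset.sum_congr rfl fun v _ => ?_
  conv_lhs => rw [prob_eq_ite]
  rw [← Finset.sum_filter, Finset.sum_mul]
  refine Finset.sum_congr rfl fun ω hω => ?_
  have h : X ω = v := by simpa using hω
  rw [fibP_eq, h, prob_eq_ite]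
  simp only [Set.mem_ofPred_eq, ← Finset.sum_filter]

theorem ent_congr_ker {Ω S T : Type*} [Fintype Ω] (p : Ω → ℝ) (X : Ω → S) (Y : Ω → T)
    (h : ∀ ω ω', p ω ≠ 0 → p ω' ≠ 0 → (X ω' = X ω ↔ Y ω' = Y ω)) : ent p X = ent p Y := by
  rw [ent_eq_fib, ent_eq_fib, neg_inj]
  refine Finset.sum_congr rfl fun ω _ => ?_
  by_cases h0 : p ω = 0
  · simp [h0]
  congr 2
  unfold fibP
  refine Finset.sum_congr rfl fun ω' _ => ?_
  by_cases h1 : p ω' = 0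
  · simp [h1]
  by_cases hh : Y ω' = Y ω
  · rw [if_pos hh, if_pos ((h ω ω' h0 h1).2 hh)]
  · rw [if_neg hh, if_neg (fun hx => hh ((h ω ω' h0 h1).1 hx))]

theorem fibP_nonneg {Ω S : Type*} [Fintype Ω] (p : Ω → ℝ) (hp : ∀ ω, 0 ≤ p ω) (X : Ω → S)
    (ω : Ω) : 0 ≤ fibP p X ω := by
  refine Finset.sum_nonneg fun ω' _ => ?_
  split_ifs
  · exact hp _
  · exact le_rfl

theorem le_fibP {Ω S : Type*} [Fintype Ω] (p : Ω → ℝ) (hp : ∀ ω, 0 ≤ p ω) (X : Ω → S)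
    (ω : Ω) : p ω ≤ fibP p X ω := by
  classical
  unfold fibP
  have := Finset.single_le_sum (f := fun ω' => if X ω' = X ω then p ω' else 0) (s := Finset.univ)
    (fun i _ => by split_ifs; exacts [hp _, le_rfl]) (Finset.mem_univ ω)
  simp only [if_true] at this
  convert this

theorem fibP_congr {Ω S : Type*} [Fintype Ω] (p : Ω → ℝ) (X : Ω → S) {ω ω' : Ω}
    (h : X ω = X ω') : fibP p X ω = fibP p X ω' := by
  unfold fibP; rw [h]

open Classical in
theorem key_sum {Ω S T U : Type*} [Fintype Ω] (p : Ω → ℝ) (hp : ∀ ω, 0 ≤ p ω)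
    (X : Ω → S) (Y : Ω → T) (Z : Ω → U)
    (hX : ∀ ω ω', X ω = X ω' → Z ω = Z ω') (hY : ∀ ω ω', Y ω = Y ω' → Z ω = Z ω') :
    ∑ ω, p ω * (fibP p X ω * fibP p Y ω / (fibP p Z ω * fibP p (fun ω => (X ω, Y ω)) ω))
      ≤ ∑ ω, p ω := by
  set W := fun ω => (X ω, Y ω) with hW
  have e1 : ∀ ω, p ω * (fibP p X ω * fibP p Y ω / (fibP p Z ω * fibP p W ω)) =
      ∑ a, ∑ b, p a * p b *
        (if X a = X ω ∧ Y b = Y ω then p ω / (fibP p Z ω * fibP p W ω) else 0) := by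
    intro ω
    have : fibP p X ω * fibP p Y ω =
        ∑ a, ∑ b, p a * p b * (if X a = X ω ∧ Y b = Y ω then 1 else 0) := by
      unfold fibP
      rw [Finset.sum_mul_sum]
      refine Finset.sum_congr rfl fun a _ => Finset.sum_congr rfl fun b _ => ?_
      by_cases h1 : X a = X ω <;> by_cases h2 : Y b = Y ω <;> simp [h1, h2]
    rw [this, Finset.sum_div, Finset.mul_sum]
    refine Finset.sum_congr rfl fun a _ => ?_
    rw [Finset.sum_div, Finset.mul_sum]
    refine Finset.sum_congr rfl fun b _ => ?_
    split_ifs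
    · ring
    · simp
  simp only [e1]
  rw [Finset.sum_comm]
  refine Finset.sum_le_sum fun a _ => ?_
  rw [Finset.sum_comm]
  have e2 : ∀ b, ∑ ω, p a * p b *
        (if X a = X ω ∧ Y b = Y ω then p ω / (fibP p Z ω * fibP p W ω) else 0) ≤
      p a / fibP p Z a * (if Z b = Z a then p b else 0) := by
    intro b
    rw [← Finset.mul_sum]
    have e3 : ∑ ω, (if X a = X ω ∧ Y b = Y ω then p ω / (fibP p Z ω * fibP p W ω) else 0) ≤
        (if Z b = Z a then 1 / fibP p Z a else 0) := by
      by_cases hex : ∃ ω₀, X a = X ω₀ ∧ Y b = Y ω₀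
      · obtain ⟨ω₀, h1, h2⟩ := hex
        have hz : Z b = Z a := (hY _ _ h2).trans (hX _ _ h1).symm
        rw [if_pos hz]
        have : ∀ ω, (if X a = X ω ∧ Y b = Y ω then p ω / (fibP p Z ω * fibP p W ω) else 0) =
            (if W ω = W ω₀ then p ω else 0) / (fibP p Z a * fibP p W ω₀) := by
          intro ω
          have hiff : (X a = X ω ∧ Y b = Y ω) ↔ W ω = W ω₀ := by
            simp only [hW, Prod.mk.injEq, h1, h2]
            constructor <;> rintro ⟨h, h'⟩ <;> exact ⟨h.symm, h'.symm⟩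
          by_cases hw : W ω = W ω₀
          · rw [if_pos (hiff.2 hw), if_pos hw, fibP_congr p W hw,
              fibP_congr p Z (hX _ _ (hiff.2 hw).1)]
          · rw [if_neg (fun h => hw (hiff.1 h)), if_neg hw, zero_div]
        simp only [this]
        rw [← Finset.sum_div]
        have hs : (∑ i, if W i = W ω₀ then p i else 0) = fibP p W ω₀ := by
          unfold fibP
          refine Finset.sum_congr rfl fun _ _ => ?_
          congr
        rw [hs]
        by_cases h0 : fibP p W ω₀ = 0
        · simp only [h0, zero_div]
          exact div_nonneg zero_le_one (fibP_nonneg p hp Z a)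
        · rw [mul_comm, ← div_div, div_self h0]
      · rw [Finset.sum_eq_zero]
        · split_ifs
          · exact div_nonneg zero_le_one (fibP_nonneg p hp Z a)
          · exact le_rfl
        · intro ω _
          rw [if_neg fun h => hex ⟨ω, h⟩]
    refine (mul_le_mul_of_nonneg_left e3 (mul_nonneg (hp a) (hp b))).trans (le_of_eq ?_)
    split_ifs
    · ring
    · simp
  refine (Finset.sum_le_sum fun b _ => e2 b).trans ?_
  rw [← Finset.mul_sum]
  change p a / fibP p Z a * fibP p Z a ≤ p a
  by_cases h0 : fibP p Z a = 0
  · simpa [h0] using hp a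
  · rw [div_mul_cancel₀ _ h0]

theorem ent_submod {Ω S T U : Type*} [Fintype Ω] (p : Ω → ℝ) (hp : ∀ ω, 0 ≤ p ω)
    (X : Ω → S) (Y : Ω → T) (Z : Ω → U)
    (hX : ∀ ω ω', X ω = X ω' → Z ω = Z ω') (hY : ∀ ω ω', Y ω = Y ω' → Z ω = Z ω') :
    ent p Z + ent p (fun ω => (X ω, Y ω)) ≤ ent p X + ent p Y := by
  have hk := key_sum p hp X Y Z hX hY
  simp only [ent_eq_fib]
  set W := fun ω => (X ω, Y ω) with hW
  have hl2 : 0 < Real.log 2 := Real.log_pos (by norm_num)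
  have : ∑ ω, (p ω * Real.logb 2 (fibP p X ω) + p ω * Real.logb 2 (fibP p Y ω)
      - p ω * Real.logb 2 (fibP p Z ω) - p ω * Real.logb 2 (fibP p W ω)) ≤
      ∑ ω, (p ω * (fibP p X ω * fibP p Y ω / (fibP p Z ω * fibP p W ω)) - p ω) / Real.log 2 := by
    refine Finset.sum_le_sum fun ω _ => ?_
    rcases (hp ω).eq_or_lt with h0 | h0
    · simp [← h0]
    have hx := h0.trans_le (le_fibP p hp X ω)
    have hy := h0.trans_le (le_fibP p hp Y ω)
    have hz := h0.trans_le (le_fibP p hp Z ω)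
    have hw := h0.trans_le (le_fibP p hp W ω)
    have hlog := Real.log_le_sub_one_of_pos (div_pos (mul_pos hx hy) (mul_pos hz hw))
    rw [Real.log_div (by positivity) (by positivity), Real.log_mul hx.ne' hy.ne',
      Real.log_mul hz.ne' hw.ne'] at hlog
    rw [le_div_iff₀ hl2]
    have := mul_le_mul_of_nonneg_left hlog h0.le
    unfold Real.logb
    field_simp
    field_simp at this
    linarith
  rw [← Finset.sum_div] at this
  have h2 := this.trans (div_nonpos_of_nonpos_of_nonneg
    (by rw [Finset.sum_sub_distrib]; exact sub_nonpos.2 hk) hl2.le)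
  simp only [Finset.sum_sub_distrib, Finset.sum_add_distrib] at h2
  linarith

theorem ent_subadd {Ω S T : Type*} [Fintype Ω] (p : Ω → ℝ) (hp : ∀ ω, 0 ≤ p ω)
    (hp1 : ∑ ω, p ω = 1) (X : Ω → S) (Y : Ω → T) :
    ent p (fun ω => (X ω, Y ω)) ≤ ent p X + ent p Y := by
  have h := ent_submod p hp X Y (fun _ => ()) (fun _ _ _ => rfl) (fun _ _ _ => rfl)
  have h0 : ent p (fun _ : Ω => ()) = 0 := by
    rw [ent_eq_fib]
    simp [fibP, hp1]
  linarith

open Classical in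
theorem prob_comp_congr {Ω S T : Type*} [Fintype Ω] (p : Ω → ℝ) (X Y : Ω → S)
    (h : ∀ v, prob p {ω | X ω = v} = prob p {ω | Y ω = v}) (f : S → T) (t : T) :
    prob p {ω | f (X ω) = t} = prob p {ω | f (Y ω) = t} := by
  have key : ∀ V : Ω → S, ∀ s : Finset S, (∀ ω, V ω ∈ s) → prob p {ω | f (V ω) = t} =
      ∑ v ∈ s, if f v = t then prob p {ω | V ω = v} else 0 := by
    intro V s hs
    simp only [prob_eq_ite, Set.mem_ofPred_eq]
    rw [← Finset.sum_fiberwise_of_maps_to (s := Finset.univ) (t := s) (g := V)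
      (fun ω _ => hs ω)]
    refine Finset.sum_congr rfl fun v _ => ?_
    rw [Finset.sum_filter]
    split_ifs with hv
    · refine Finset.sum_congr rfl fun ω _ => ?_
      by_cases hh : V ω = v <;> simp [hh, hv]
    · refine Finset.sum_eq_zero fun ω _ => ?_
      by_cases hh : V ω = v <;> simp [hh, hv]
  rw [key X (Finset.univ.image X ∪ Finset.univ.image Y) (by simp),
    key Y (Finset.univ.image X ∪ Finset.univ.image Y) (by simp)]
  simp only [h]

open Classical in
theorem ent_congr_dist {Ω S : Type*} [Fintype Ω] (p : Ω → ℝ) (X Y : Ω → S)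
    (h : ∀ v, prob p {ω | X ω = v} = prob p {ω | Y ω = v}) : ent p X = ent p Y := by
  rw [ent_eq_of_subset p X (Finset.univ.image X ∪ Finset.univ.image Y)
    Finset.subset_union_left,
    ent_eq_of_subset p Y (Finset.univ.image X ∪ Finset.univ.image Y)
    Finset.subset_union_right]
  simp only [h]

theorem entropy_difference_product_step {Ω R : Type*} [Fintype Ω] [CommRing R] [NoZeroDivisors R]
    (p : Ω → ℝ) (hp : ∀ ω, 0 ≤ p ω) (hp1 : ∑ ω, p ω = 1) (A B C : Ω → R)
    (hA0 : prob p {ω | A ω = 0} = 0) :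
    (ent p (fun ω => A ω * (B ω - C ω)) + ent p (fun ω => (A ω, B ω, C ω)) ≤
      ent p (fun ω => (A ω, B ω - C ω)) + ent p (fun ω => (A ω * B ω, A ω * C ω))) ∧
    ((∀ a b c : R, prob p {ω | A ω = a ∧ B ω = b ∧ C ω = c} =
        prob p {ω | A ω = a} * prob p {ω | B ω = b} * prob p {ω | C ω = c}) →
      (∀ r : R, prob p {ω | B ω = r} = prob p {ω | A ω = r}) →
      (∀ r : R, prob p {ω | C ω = r} = prob p {ω | A ω = r}) →
      ent p (fun ω => A ω * (B ω - C ω)) ≤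
        2 * ent p (fun ω => A ω * B ω) + ent p (fun ω => A ω - B ω) - 2 * ent p A) := by
  classical
  have hA : ∀ ω, p ω ≠ 0 → A ω ≠ 0 := by
    intro ω h0 ha
    rw [prob_eq_ite] at hA0
    rw [Finset.sum_eq_zero_iff_of_nonneg
      (fun i _ => by split_ifs; exacts [hp _, le_rfl])] at hA0
    have := hA0 ω (Finset.mem_univ _)
    rw [if_pos (show ω ∈ {ω | A ω = 0} from ha)] at this
    exact h0 this
  have main : ent p (fun ω => A ω * (B ω - C ω)) + ent p (fun ω => (A ω, B ω, C ω)) ≤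
      ent p (fun ω => (A ω, B ω - C ω)) + ent p (fun ω => (A ω * B ω, A ω * C ω)) := by
    have h := ent_submod p hp (fun ω => (A ω, B ω - C ω)) (fun ω => (A ω * B ω, A ω * C ω))
      (fun ω => A ω * (B ω - C ω))
      (by
        intro ω ω' h
        simp only [Prod.mk.injEq] at h
        simp only [h.1, h.2])
      (by
        intro ω ω' h
        simp only [Prod.mk.injEq] at h
        simp only [mul_sub, h.1, h.2])
    rw [ent_congr_ker p (fun ω => (A ω, B ω, C ω))
      (fun ω => ((A ω, B ω - C ω), (A ω * B ω, A ω * C ω)))]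
    · exact h
    · intro ω ω' h0 h1
      simp only [Prod.mk.injEq]
      constructor
      · rintro ⟨ha, hb, hc⟩
        simp [ha, hb, hc]
      · rintro ⟨⟨ha, -⟩, hb, hc⟩
        rw [ha] at hb hc
        exact ⟨ha, mul_left_cancel₀ (hA ω h0) hb, mul_left_cancel₀ (hA ω h0) hc⟩
  refine ⟨main, fun hind hB hC => ?_⟩
  have hABC : ∀ v : R × R × R, prob p {ω | (A ω, B ω, C ω) = v} =
      prob p {ω | A ω = v.1} * prob p {ω | A ω = v.2.1} * prob p {ω | A ω = v.2.2} := by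
    rintro ⟨a, b, c⟩
    simp only [Prod.mk.injEq]
    rw [hind, hB, hC]
  have hACB : ∀ v : R × R × R, prob p {ω | (A ω, C ω, B ω) = v} =
      prob p {ω | A ω = v.1} * prob p {ω | A ω = v.2.1} * prob p {ω | A ω = v.2.2} := by
    rintro ⟨a, b, c⟩
    have h := hABC (a, c, b)
    simp only [Prod.mk.injEq] at h ⊢
    rw [mul_right_comm, ← h]
    congr 1
    ext ω
    simp only [Set.mem_ofPred_eq]
    tauto
  have hBCA : ∀ v : R × R × R, prob p {ω | (B ω, C ω, A ω) = v} =
      prob p {ω | A ω = v.1} * prob p {ω | A ω = v.2.1} * prob p {ω | A ω = v.2.2} := by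
    rintro ⟨a, b, c⟩
    have h := hABC (c, a, b)
    simp only [Prod.mk.injEq] at h ⊢
    rw [mul_comm, ← mul_assoc, ← h]
    congr 1
    ext ω
    simp only [Set.mem_ofPred_eq]
    tauto
  have e1 : ent p (fun ω => A ω * C ω) = ent p (fun ω => A ω * B ω) :=
    ent_congr_dist p _ _ (prob_comp_congr p (fun ω => (A ω, C ω, B ω)) (fun ω => (A ω, B ω, C ω))
      (fun v => (hACB v).trans (hABC v).symm) (fun v => v.1 * v.2.1))
  have e2 : ent p (fun ω => B ω - C ω) = ent p (fun ω => A ω - B ω) :=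
    ent_congr_dist p _ _ (prob_comp_congr p (fun ω => (B ω, C ω, A ω)) (fun ω => (A ω, B ω, C ω))
      (fun v => (hBCA v).trans (hABC v).symm) (fun v => v.1 - v.2.1))
  have eB : ent p B = ent p A := ent_congr_dist p _ _ hB
  have eC : ent p C = ent p A := ent_congr_dist p _ _ hC
  have e3 : ent p (fun ω => (A ω, B ω, C ω)) = ent p A + ent p B + ent p C := by
    simp only [ent_eq_fib]
    rw [← neg_add, ← neg_add, neg_inj, ← Finset.sum_add_distrib, ← Finset.sum_add_distrib]
    refine Finset.sum_congr rfl fun ω _ => ?_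
    rcases (hp ω).eq_or_lt with h0 | h0
    · simp [← h0]
    have hx := h0.trans_le (le_fibP p hp A ω)
    have hy := h0.trans_le (le_fibP p hp B ω)
    have hz := h0.trans_le (le_fibP p hp C ω)
    have : fibP p (fun ω => (A ω, B ω, C ω)) ω = fibP p A ω * fibP p B ω * fibP p C ω := by
      simp only [fibP_eq, Prod.mk.injEq]
      exact hind _ _ _
    rw [this, Real.logb_mul (by positivity) hz.ne', Real.logb_mul hx.ne' hy.ne']
    ring
  have s1 := ent_subadd p hp hp1 A (fun ω => B ω - C ω)
  have s2 := ent_subadd p hp hp1 (fun ω => A ω * B ω) (fun ω => A ω * C ω)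
  linarith
end

section
/- Let A, B, C, D be independent identically distributed discrete random variables taking finitely many nonzero values in a field. Then: H((A − B)/(C − D)) + 5 H(A) ≤ 4 H(AB) + 2 H(A − B); H((A + B)/(C + D)) + 5 H(A) ≤ 4 H(AB) + 2 H(A + B); H((A − B)/(C − D)) + 4 H(A) ≤ 3 H(A/B) + 2 H(A − B); and H((A + B)/(C + D)) + 4 H(A) ≤ 3 H(A/B) + 2 H(A + B). -/
/-- The quotient `x / y`, taking the value `∞` (here `none`, a fixed element outside the
field) when the denominator is `0`. -/
noncomputable def ratio {F : Type*} [Field F] (x y : F) : Option F :=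
  letI := Classical.decEq F
  if y = 0 then none else some (x / y)


open Classical in
lemma prob_ite {Ω : Type*} [Fintype Ω] (p : Ω → ℝ) (E : Ω → Prop) :
    prob p {ω | E ω} = ∑ ω, if E ω then p ω else 0 := by
  unfold prob
  refine Finset.sum_congr rfl fun ω _ => ?_
  simp [Set.indicator_apply]

lemma prob_congr {Ω : Type*} [Fintype Ω] (p : Ω → ℝ) {E G : Ω → Prop} (h : ∀ ω, E ω ↔ G ω) :
    prob p {ω | E ω} = prob p {ω | G ω} := by
  have : E = G := funext fun ω => propext (h ω)
  rw [this]

lemma prob_nonneg' {Ω : Type*} [Fintype Ω] (p : Ω → ℝ) (hp : ∀ ω, 0 ≤ p ω) (E : Set Ω) :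
    0 ≤ prob p E :=
  Finset.sum_nonneg fun ω _ => Set.indicator_nonneg (fun x _ => hp x) ω

lemma prob_mono' {Ω : Type*} [Fintype Ω] (p : Ω → ℝ) (hp : ∀ ω, 0 ≤ p ω) {E G : Ω → Prop}
    (h : ∀ ω, E ω → G ω) :
    prob p {ω | E ω} ≤ prob p {ω | G ω} :=
  Finset.sum_le_sum fun ω _ =>
    Set.indicator_le_indicator_of_subset (fun ω hω => h ω hω) hp ω

lemma prob_false {Ω : Type*} [Fintype Ω] (p : Ω → ℝ) {E : Ω → Prop} (h : ∀ ω, ¬ E ω) :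
    prob p {ω | E ω} = 0 := by
  classical
  rw [prob_ite]
  exact Finset.sum_eq_zero fun ω _ => by simp [h ω]

/-- The probability of the value taken at `ω`. -/
noncomputable def pv {Ω S : Type*} [Fintype Ω] (p : Ω → ℝ) (X : Ω → S) (ω : Ω) : ℝ :=
  prob p {ω' | X ω' = X ω}

lemma pv_pos {Ω S : Type*} [Fintype Ω] (p : Ω → ℝ) (hp : ∀ ω, 0 < p ω) (X : Ω → S) (ω : Ω) :
    0 < pv p X ω := by
  classical
  unfold pv
  rw [prob_ite]
  refine Finset.sum_pos' (fun i _ => ?_) ⟨ω, Finset.mem_univ _, ?_⟩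
  · split_ifs
    · exact (hp i).le
    · exact le_rfl
  · simp [hp ω]

/-- Natural-log entropy as an expectation. -/
noncomputable def hn {Ω S : Type*} [Fintype Ω] (p : Ω → ℝ) (X : Ω → S) : ℝ :=
  ∑ ω, p ω * (- Real.log (pv p X ω))

lemma ent_eq_hn {Ω S : Type*} [Fintype Ω] (p : Ω → ℝ) (X : Ω → S) :
    ent p X = hn p X / Real.log 2 := by
  classical
  have e : ent p X = ∑ v ∈ Finset.univ.image X,
      -(prob p {ω | X ω = v} * Real.logb 2 (prob p {ω | X ω = v})) := by
    unfold ent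
    refine Finset.sum_congr ?_ fun _ _ => rfl
    ext; simp
  rw [e, hn, Finset.sum_div,
    ← Finset.sum_fiberwise_of_maps_to (s := Finset.univ) (t := Finset.univ.image X) (g := X)
      (fun i _ => Finset.mem_image_of_mem _ (Finset.mem_univ i))]
  refine Finset.sum_congr rfl fun v _ => ?_
  have : ∀ ω ∈ Finset.univ.filter (fun i => X i = v),
      p ω * -Real.log (pv p X ω) / Real.log 2 =
      p ω * (-Real.log (prob p {ω | X ω = v}) / Real.log 2) := by
    intro ω hω
    simp only [Finset.mem_filter, Finset.mem_univ, true_and] at hω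
    subst hω
    unfold pv
    ring
  rw [Finset.sum_congr rfl this, ← Finset.sum_mul, Finset.sum_filter, ← prob_ite, Real.logb]
  ring

/-- Same law. -/
def SL {Ω Ω' S : Type*} [Fintype Ω] [Fintype Ω'] (p : Ω → ℝ) (X : Ω → S)
    (p' : Ω' → ℝ) (X' : Ω' → S) : Prop :=
  ∀ v, prob p {ω | X ω = v} = prob p' {ω | X' ω = v}

lemma SL.ent_eq {Ω Ω' S : Type*} [Fintype Ω] [Fintype Ω'] {p : Ω → ℝ} {X : Ω → S}
    {p' : Ω' → ℝ} {X' : Ω' → S} (h : SL p X p' X') : ent p X = ent p' X' := by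
  classical
  have key : ∀ {Ω : Type _} [Fintype Ω] (p : Ω → ℝ) (X : Ω → S) (T : Finset S),
      (Finset.univ.image X) ⊆ T → ent p X = ∑ v ∈ T,
      -(prob p {ω | X ω = v} * Real.logb 2 (prob p {ω | X ω = v})) := by
    intro Ω _ p X T hT
    rw [← Finset.sum_subset hT]
    · unfold ent
      refine Finset.sum_congr ?_ fun _ _ => rfl
      ext; simp
    · intro v _ hv
      rw [prob_false]
      · simp
      · rintro ω rfl
        exact hv (Finset.mem_image_of_mem _ (Finset.mem_univ _))
  have key' : ∀ {Ω : Type _} [Fintype Ω] (p : Ω → ℝ) (X : Ω → S) (T : Finset S),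
      (Finset.univ.image X) ⊆ T → ent p X = ∑ v ∈ T,
      -(prob p {ω | X ω = v} * Real.logb 2 (prob p {ω | X ω = v})) := by
    intro Ω _ p X T hT
    rw [← Finset.sum_subset hT]
    · unfold ent
      refine Finset.sum_congr ?_ fun _ _ => rfl
      ext; simp
    · intro v _ hv
      rw [prob_false]
      · simp
      · rintro ω rfl
        exact hv (Finset.mem_image_of_mem _ (Finset.mem_univ _))
  rw [key p X (Finset.univ.image X ∪ Finset.univ.image X') Finset.subset_union_left,
    key' p' X' (Finset.univ.image X ∪ Finset.univ.image X') Finset.subset_union_right]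
  refine Finset.sum_congr rfl fun v _ => ?_
  rw [h v]

open Classical in
lemma prob_comp {Ω S : Type*} [Fintype Ω] (p : Ω → ℝ) (X : Ω → S) (E : S → Prop) (T : Finset S)
    (hT : ∀ ω, X ω ∈ T) :
    prob p {ω | E (X ω)} = ∑ s ∈ T, if E s then prob p {ω | X ω = s} else 0 := by
  rw [prob_ite, ← Finset.sum_fiberwise_of_maps_to (s := Finset.univ) (t := T) (g := X)
    (fun i _ => hT i)]
  refine Finset.sum_congr rfl fun s _ => ?_
  rw [prob_ite, Finset.sum_filter]
  split_ifs with h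
  · refine Finset.sum_congr rfl fun ω _ => ?_
    by_cases hx : X ω = s
    · subst hx; simp [h]
    · simp [hx]
  · refine Finset.sum_eq_zero fun ω _ => ?_
    by_cases hx : X ω = s
    · subst hx; simp [h]
    · simp [hx]

lemma SL.prob_eq {Ω Ω' S : Type*} [Fintype Ω] [Fintype Ω'] {p : Ω → ℝ} {X : Ω → S}
    {p' : Ω' → ℝ} {X' : Ω' → S} (h : SL p X p' X') (E : S → Prop) :
    prob p {ω | E (X ω)} = prob p' {ω | E (X' ω)} := by
  classical
  rw [prob_comp p X E (Finset.univ.image X ∪ Finset.univ.image X') (by intro ω; simp),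
    prob_comp p' X' E (Finset.univ.image X ∪ Finset.univ.image X') (by intro ω; simp)]
  refine Finset.sum_congr rfl fun v _ => ?_
  rw [h v]

lemma SL.comp {Ω Ω' S T : Type*} [Fintype Ω] [Fintype Ω'] {p : Ω → ℝ} {X : Ω → S}
    {p' : Ω' → ℝ} {X' : Ω' → S} (h : SL p X p' X') (g : S → T) :
    SL p (fun ω => g (X ω)) p' (fun ω => g (X' ω)) :=
  fun v => h.prob_eq (fun s => g s = v)

/-- Submodularity of entropy. -/
lemma hn_submod {Ω S₁ S₂ S₃ S₄ : Type*} [Fintype Ω] (p : Ω → ℝ) (hp : ∀ ω, 0 < p ω)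
    (hp1 : ∑ ω, p ω = 1) (W : Ω → S₁) (X : Ω → S₂) (U : Ω → S₃) (V : Ω → S₄)
    (hW : ∀ ω ω', U ω = U ω' → V ω = V ω' → W ω = W ω')
    (hXU : ∀ ω ω', U ω = U ω' → X ω = X ω')
    (hXV : ∀ ω ω', V ω = V ω' → X ω = X ω') :
    hn p W + hn p X ≤ hn p U + hn p V := by
  classical
  have pW := pv_pos p hp W
  have pX := pv_pos p hp X
  have pU := pv_pos p hp U
  have pV := pv_pos p hp V
  have h1 : hn p W + hn p X - (hn p U + hn p V) ≤
      ∑ ω, p ω * (pv p U ω * pv p V ω / (pv p W ω * pv p X ω)) - 1 := by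
    rw [← hp1]
    unfold hn
    rw [← Finset.sum_add_distrib, ← Finset.sum_add_distrib, ← Finset.sum_sub_distrib,
      ← Finset.sum_sub_distrib]
    refine Finset.sum_le_sum fun ω _ => ?_
    have h2 : Real.log (pv p U ω * pv p V ω / (pv p W ω * pv p X ω)) =
        Real.log (pv p U ω) + Real.log (pv p V ω) - (Real.log (pv p W ω) + Real.log (pv p X ω)) := by
      rw [Real.log_div (mul_pos (pU ω) (pV ω)).ne' (mul_pos (pW ω) (pX ω)).ne',
        Real.log_mul (pU ω).ne' (pV ω).ne', Real.log_mul (pW ω).ne' (pX ω).ne']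
    have h3 := Real.log_le_sub_one_of_pos
      (div_pos (mul_pos (pU ω) (pV ω)) (mul_pos (pW ω) (pX ω)))
    rw [h2] at h3
    have := mul_le_mul_of_nonneg_left h3 (hp ω).le
    linarith
  have inner : ∀ ω₁ ω₂, ∑ ω, (if U ω₁ = U ω ∧ V ω₂ = V ω then
      p ω / (pv p W ω * pv p X ω) else 0) ≤ if X ω₂ = X ω₁ then 1 / pv p X ω₁ else 0 := by
    intro ω₁ ω₂
    by_cases hex : ∃ ω₀, U ω₁ = U ω₀ ∧ V ω₂ = V ω₀
    · obtain ⟨ω₀, hu, hv⟩ := hex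
      rw [if_pos ((hXV _ _ hv).trans (hXU _ _ hu).symm)]
      have : ∀ ω, (if U ω₁ = U ω ∧ V ω₂ = V ω then p ω / (pv p W ω * pv p X ω) else 0) ≤
          (if W ω = W ω₀ then p ω else 0) * (1 / (pv p W ω₀ * pv p X ω₁)) := by
        intro ω
        split_ifs with ha hb hb
        · have e1 : pv p W ω = pv p W ω₀ := by unfold pv; rw [hb]
          have e2 : pv p X ω = pv p X ω₁ := by unfold pv; rw [hXU _ _ ha.1]
          rw [e1, e2, mul_one_div]
        · exact absurd (hW _ _ (ha.1.symm.trans hu) (ha.2.symm.trans hv)) hb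
        · exact mul_nonneg (hp ω).le (one_div_pos.2 (mul_pos (pW _) (pX _))).le
        · simp
      refine (Finset.sum_le_sum fun ω _ => this ω).trans ?_
      rw [← Finset.sum_mul, ← prob_ite]
      change pv p W ω₀ * _ ≤ _
      have := (pW ω₀).ne'
      have := (pX ω₁).ne'
      apply le_of_eq
      field_simp
    · push Not at hex
      refine le_trans (le_of_eq (Finset.sum_eq_zero fun ω _ => ?_)) ?_
      · rw [if_neg]
        rintro ⟨a, b⟩
        exact hex ω a b
      · split_ifs
        · exact (one_div_pos.2 (pX _)).le
        · exact le_rfl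
  have h2 : ∑ ω, p ω * (pv p U ω * pv p V ω / (pv p W ω * pv p X ω)) ≤ 1 := by
    calc ∑ ω, p ω * (pv p U ω * pv p V ω / (pv p W ω * pv p X ω))
        = ∑ ω, ∑ ω₁, ∑ ω₂, p ω₁ * p ω₂ * (if U ω₁ = U ω ∧ V ω₂ = V ω then
          p ω / (pv p W ω * pv p X ω) else 0) := by
          refine Finset.sum_congr rfl fun ω _ => ?_
          have : p ω * (pv p U ω * pv p V ω / (pv p W ω * pv p X ω)) =
            (pv p U ω * pv p V ω) * (p ω / (pv p W ω * pv p X ω)) := by ring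
          rw [this]
          have e : pv p U ω * pv p V ω = (∑ ω₁, if U ω₁ = U ω then p ω₁ else 0) *
              (∑ ω₂, if V ω₂ = V ω then p ω₂ else 0) := by
            rw [← prob_ite, ← prob_ite]; rfl
          rw [e, Finset.sum_mul_sum, Finset.sum_mul]
          refine Finset.sum_congr rfl fun ω₁ _ => ?_
          rw [Finset.sum_mul]
          refine Finset.sum_congr rfl fun ω₂ _ => ?_
          by_cases ha : U ω₁ = U ω <;> by_cases hb : V ω₂ = V ω <;> simp [ha, hb]
      _ = ∑ ω₁, ∑ ω₂, p ω₁ * p ω₂ * ∑ ω, (if U ω₁ = U ω ∧ V ω₂ = V ω then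
          p ω / (pv p W ω * pv p X ω) else 0) := by
          rw [Finset.sum_comm]
          refine Finset.sum_congr rfl fun ω₁ _ => ?_
          rw [Finset.sum_comm]
          refine Finset.sum_congr rfl fun ω₂ _ => ?_
          rw [Finset.mul_sum]
      _ ≤ ∑ ω₁, ∑ ω₂, p ω₁ * p ω₂ * (if X ω₂ = X ω₁ then 1 / pv p X ω₁ else 0) :=
          Finset.sum_le_sum fun ω₁ _ => Finset.sum_le_sum fun ω₂ _ =>
            mul_le_mul_of_nonneg_left (inner ω₁ ω₂) (mul_pos (hp _) (hp _)).le
      _ = ∑ ω₁, p ω₁ := by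
          refine Finset.sum_congr rfl fun ω₁ _ => ?_
          have : ∀ ω₂, p ω₁ * p ω₂ * (if X ω₂ = X ω₁ then 1 / pv p X ω₁ else 0) =
            (if X ω₂ = X ω₁ then p ω₂ else 0) * (p ω₁ / pv p X ω₁) := by
            intro ω₂; split_ifs <;> ring
          rw [Finset.sum_congr rfl fun ω₂ _ => this ω₂, ← Finset.sum_mul, ← prob_ite]
          change pv p X ω₁ * _ = _
          have := (pX ω₁).ne'
          field_simp
      _ = 1 := hp1
  linarith

lemma hn_pair {Ω S₁ S₂ : Type*} [Fintype Ω] (p : Ω → ℝ) (hp : ∀ ω, 0 < p ω)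
    (hp1 : ∑ ω, p ω = 1) (U : Ω → S₁) (V : Ω → S₂) :
    hn p (fun ω => (U ω, V ω)) ≤ hn p U + hn p V := by
  classical
  have h := hn_submod p hp hp1 (fun ω => (U ω, V ω)) (fun _ => ()) U V
    (fun ω ω' h1 h2 => by simp [h1, h2]) (fun _ _ _ => rfl) (fun _ _ _ => rfl)
  have : hn p (fun _ => ()) = 0 := by
    unfold hn
    refine Finset.sum_eq_zero fun ω _ => ?_
    have : pv p (fun _ => ()) ω = 1 := by
      unfold pv; rw [prob_ite]; simpa using hp1
    rw [this]; simp
  linarith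

/-- Product weight. -/
def pw {α β : Type*} (p : α → ℝ) (q : β → ℝ) (x : α × β) : ℝ := p x.1 * q x.2

lemma prob_pw {α β : Type*} [Fintype α] [Fintype β] (p : α → ℝ) (q : β → ℝ)
    (E : α → Prop) (G : β → Prop) :
    prob (pw p q) {x | E x.1 ∧ G x.2} = prob p {a | E a} * prob q {b | G b} := by
  classical
  rw [prob_ite, prob_ite, prob_ite, Fintype.sum_prod_type, Finset.sum_mul_sum]
  refine Finset.sum_congr rfl fun a _ => Finset.sum_congr rfl fun b _ => ?_
  by_cases ha : E a <;> by_cases hb : G b <;> simp [ha, hb, pw]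

lemma sum_pw {α β : Type*} [Fintype α] [Fintype β] (p : α → ℝ) (q : β → ℝ)
    (h : ∑ a, p a = 1) (h' : ∑ b, q b = 1) : ∑ x, pw p q x = 1 := by
  unfold pw
  rw [Fintype.sum_prod_type]
  simp only [← Finset.mul_sum, h', mul_one, h]

lemma prob_univ' {α : Type*} [Fintype α] (p : α → ℝ) (h : ∑ a, p a = 1) :
    prob p {_a | True} = 1 := by
  classical
  rw [prob_ite]; simpa using h

/-- Five independent copies. -/
def w5 {S : Type*} (w : S → ℝ) : (S × S) × (S × S) × S → ℝ := pw (pw w w) (pw (pw w w) w)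

lemma prob5 {S : Type*} [Fintype S] (w : S → ℝ) (E₁ E₂ E₃ E₄ E₅ : S → Prop) :
    prob (w5 w) {x | E₁ x.1.1 ∧ E₂ x.1.2 ∧ E₃ x.2.1.1 ∧ E₄ x.2.1.2 ∧ E₅ x.2.2} =
    prob w {a | E₁ a} * prob w {a | E₂ a} * prob w {a | E₃ a} * prob w {a | E₄ a} *
      prob w {a | E₅ a} := by
  have h1 := prob_pw w w E₁ E₂
  have h2 := prob_pw w w E₃ E₄
  have h3 := prob_pw (pw w w) w (fun y => E₃ y.1 ∧ E₄ y.2) E₅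
  have h4 := prob_pw (pw w w) (pw (pw w w) w) (fun y => E₁ y.1 ∧ E₂ y.2)
    (fun y => (E₃ y.1.1 ∧ E₄ y.1.2) ∧ E₅ y.2)
  rw [h3, h2, h1] at h4
  unfold w5
  rw [prob_congr _ (G := fun x => (E₁ x.1.1 ∧ E₂ x.1.2) ∧
    (E₃ x.2.1.1 ∧ E₄ x.2.1.2) ∧ E₅ x.2.2) (fun x => by tauto), h4]
  ring

lemma prob_single {S : Type*} [Fintype S] (w : S → ℝ) (x : S) : prob w {a | a = x} = w x := by
  classical
  rw [prob_ite]; simp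

lemma ratio_scale {F : Type*} [Field F] (t x y : F) (ht : t ≠ 0) :
    ratio (t * x) (t * y) = ratio x y := by
  classical
  unfold ratio
  by_cases hy : y = 0
  · simp [hy]
  · simp [hy, ht, mul_div_mul_left]

section core

variable {S F : Type*} [Fintype S] [Field F] (w : S → ℝ) (v : S → F) (s : F)

/-- Difference (or sum). -/
def df (y : S × S) : F := v y.1 - s * v y.2

/-- Degenerate event. -/
def ZZ (x : (S × S) × (S × S) × S) : Prop := df v s x.1 = 0 ∧ df v s x.2.1 = 0

/-- Slope. -/
noncomputable def XX (x : (S × S) × (S × S) × S) : Option F := ratio (df v s x.1) (df v s x.2.1)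

/-- Refined slope. -/
noncomputable def XX' (x : (S × S) × (S × S) × S) : Option F × Prop := (XX v s x, ZZ v s x)

/-- Differences. -/
def UU (x : (S × S) × (S × S) × S) : F × F := (df v s x.1, df v s x.2.1)

open Classical in
/-- Refined differences. -/
noncomputable def UU' (x : (S × S) × (S × S) × S) : (F × F) × Option S :=
  (UU v s x, if ZZ v s x then some x.1.1 else none)

lemma w5_pos (hw : ∀ a, 0 < w a) (x) : 0 < w5 w x := by
  unfold w5 pw
  have := hw x.1.1
  have := hw x.1.2
  have := hw x.2.1.1
  have := hw x.2.1.2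
  have := hw x.2.2
  positivity

lemma w5_sum (hw1 : ∑ a, w a = 1) : ∑ x, w5 w x = 1 :=
  sum_pw _ _ (sum_pw _ _ hw1 hw1) (sum_pw _ _ (sum_pw _ _ hw1 hw1) hw1)

lemma prob_blocks (hw1 : ∑ a, w a = 1) (E G : S × S → Prop) :
    prob (w5 w) {x | E x.1 ∧ G x.2.1} = prob (pw w w) {y | E y} * prob (pw w w) {y | G y} := by
  have h1 := prob_pw (pw w w) (pw (pw w w) w) E (fun y => G y.1 ∧ True)
  rw [prob_pw (pw w w) w G (fun _ => True), prob_univ' w hw1, mul_one] at h1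
  rw [← h1]
  exact prob_congr _ fun x => by tauto

/-- Probability of the zero difference. -/
noncomputable def qq : ℝ := prob (pw w w) {y | df v s y = 0}

lemma pvU (hw1 : ∑ a, w a = 1) (x) (hx : ZZ v s x) :
    pv (w5 w) (UU v s) x = qq w v s * qq w v s := by
  unfold pv qq
  rw [← prob_blocks w hw1]
  refine prob_congr _ fun y => ?_
  simp only [UU, hx.1, hx.2, Prod.mk.injEq]

lemma pvX (hw1 : ∑ a, w a = 1) (x) (hx : ZZ v s x) :
    pv (w5 w) (XX v s) x = qq w v s := by
  have h := prob_blocks w hw1 (fun _ => True) (fun y => df v s y = 0)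
  rw [prob_univ' _ (sum_pw _ _ hw1 hw1), one_mul] at h
  unfold pv qq
  rw [← h]
  refine prob_congr _ fun y => ?_
  simp only [XX, ratio, hx.2, if_true]
  by_cases h : df v s y.2.1 = 0 <;> simp [h]

lemma pvX' (hw1 : ∑ a, w a = 1) (x) (hx : ZZ v s x) :
    pv (w5 w) (XX' v s) x = qq w v s * qq w v s := by
  unfold pv qq
  rw [← prob_blocks w hw1]
  refine prob_congr _ fun y => ?_
  constructor
  · intro h
    have h2 : ZZ v s y = ZZ v s x := congrArg Prod.snd h
    have : ZZ v s y := by rw [h2]; exact hx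
    exact this
  · intro h
    have hy : ZZ v s y := h
    have h2 : ZZ v s y = ZZ v s x := by simp [hx, hy]
    simp [XX', h2, XX, ratio, hx.2, hy.2]

lemma pvU' (hw1 : ∑ a, w a = 1) (hv : Function.Injective v) (hs : s * s = 1)
    (x) (hx : ZZ v s x) :
    pv (w5 w) (UU' v s) x = w x.1.1 * w x.1.2 * qq w v s := by
  have h := prob_blocks w hw1 (fun y => y = x.1) (fun y => df v s y = 0)
  rw [prob_single] at h
  change _ = pw w w x.1 * _
  unfold pv qq
  rw [← h]
  refine prob_congr _ fun y => ?_
  constructor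
  · intro h
    simp only [UU', hx, if_true, Prod.mk.injEq] at h
    obtain ⟨h1, h2⟩ := h
    have hy : ZZ v s y := by
      by_contra hy
      simp [hy] at h2
    simp only [hy, if_true, Option.some.injEq] at h2
    refine ⟨?_, hy.2⟩
    have a1 := hx.1
    have a2 := hy.1
    simp only [df, h2] at a1 a2
    refine Prod.ext h2 (hv ?_)
    have : s * (s * v y.1.2) = s * (s * v x.1.2) := by
      congr 1
      linear_combination a1 - a2
    rw [← mul_assoc, ← mul_assoc, hs] at this
    simpa using this
  · rintro ⟨h1, h2⟩
    have hy : ZZ v s y := ⟨by rw [h1]; exact hx.1, h2⟩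
    simp [UU', UU, hx, hy, h1, h2, hx.2]

lemma pvU'_off (x) (hx : ¬ ZZ v s x) :
    pv (w5 w) (UU' v s) x = pv (w5 w) (UU v s) x := by
  refine prob_congr _ fun y => ?_
  simp only [UU', hx, if_false, Prod.mk.injEq]
  constructor
  · exact fun h => h.1
  · intro h
    refine ⟨h, ?_⟩
    have : ¬ ZZ v s y := by
      intro hy
      simp only [UU, Prod.mk.injEq] at h
      exact hx ⟨h.1.symm.trans hy.1, h.2.symm.trans hy.2⟩
    simp [this]

lemma pvX'_le (hw : ∀ a, 0 < w a) (x) : pv (w5 w) (XX' v s) x ≤ pv (w5 w) (XX v s) x :=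
  prob_mono' _ (fun y => (w5_pos w hw y).le) fun _ h => congrArg Prod.fst h

lemma df_one_le (hw : ∀ a, 0 < w a) (hw1 : ∑ a, w a = 1) (hv : Function.Injective v) :
    prob (pw (fun _ => 1) w) {y | df v s y = 0} ≤ 1 := by
  classical
  rw [prob_ite, Fintype.sum_prod_type, Finset.sum_comm]
  refine le_trans ?_ hw1.le
  refine Finset.sum_le_sum fun b _ => ?_
  simp only [pw, one_mul]
  rw [← Finset.sum_filter, Finset.sum_const, nsmul_eq_mul]
  refine mul_le_of_le_one_left (hw b).le ?_
  norm_cast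
  rw [Finset.card_le_one]
  intro a ha a' ha'
  replace ha := (Finset.mem_filter.1 ha).2
  replace ha' := (Finset.mem_filter.1 ha').2
  simp only [df] at ha ha'
  apply hv
  linear_combination ha - ha'

lemma df_one_le' (hw : ∀ a, 0 < w a) (hw1 : ∑ a, w a = 1) (hv : Function.Injective v)
    (hs : s * s = 1) :
    prob (pw w (fun _ => 1)) {y | df v s y = 0} ≤ 1 := by
  classical
  rw [prob_ite, Fintype.sum_prod_type]
  refine le_trans ?_ hw1.le
  refine Finset.sum_le_sum fun b _ => ?_
  simp only [pw, mul_one]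
  rw [← Finset.sum_filter, Finset.sum_const, nsmul_eq_mul]
  refine mul_le_of_le_one_left (hw b).le ?_
  norm_cast
  rw [Finset.card_le_one]
  intro a ha a' ha'
  replace ha := (Finset.mem_filter.1 ha).2
  replace ha' := (Finset.mem_filter.1 ha').2
  simp only [df] at ha ha'
  apply hv
  linear_combination s * (ha' - ha) - (v a - v a') * hs

open Classical in
lemma kl_bound (hw : ∀ a, 0 < w a) (hw1 : ∑ a, w a = 1) (r : S × S → ℝ) (w' : S × S → ℝ)
    (hr : ∀ y, 0 < r y) (hr' : ∀ y, pw w w y / r y = w' y)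
    (h1 : prob w' {y | df v s y = 0} ≤ 1) :
    ∑ x, (if ZZ v s x then w5 w x * Real.log (qq w v s / r x.1) else 0) ≤ 0 := by
  have q0 : 0 ≤ qq w v s := prob_nonneg' _ (fun y => (mul_pos (hw _) (hw _)).le) _
  rcases q0.eq_or_lt with q0 | q0
  · rw [← q0]
    simp
  have e1 : ∑ x, (if ZZ v s x then w5 w x else 0) = qq w v s * qq w v s := by
    rw [← prob_ite]
    exact prob_blocks w hw1 (fun y => df v s y = 0) (fun y => df v s y = 0)
  have e2 : ∑ x : (S × S) × (S × S) × S, (if ZZ v s x then w5 w x / r x.1 else 0) =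
      prob w' {y | df v s y = 0} * qq w v s := by
    have h := prob_pw w' (pw (pw w w) w) (fun y => df v s y = 0)
      (fun y => df v s y.1 = 0 ∧ True)
    rw [prob_pw (pw w w) w (fun y => df v s y = 0) (fun _ => True), prob_univ' w hw1, mul_one] at h
    unfold qq
    rw [← h, prob_ite]
    refine Finset.sum_congr rfl fun x _ => ?_
    have : w5 w x / r x.1 = pw w' (pw (pw w w) w) x := by
      rw [pw, ← hr', w5, pw]; ring
    rw [this]
    by_cases hz : df v s x.1 = 0 <;> by_cases hz' : df v s x.2.1 = 0 <;> simp [ZZ, hz, hz']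
  calc _ ≤ ∑ x, ((if ZZ v s x then w5 w x / r x.1 else 0) * qq w v s -
        (if ZZ v s x then w5 w x else 0)) := by
        refine Finset.sum_le_sum fun x _ => ?_
        split_ifs
        · have h3 := Real.log_le_sub_one_of_pos (div_pos q0 (hr x.1))
          have := mul_le_mul_of_nonneg_left h3 (w5_pos w hw x).le
          refine this.trans (le_of_eq ?_)
          ring
        · simp
    _ = prob w' {y | df v s y = 0} * qq w v s * qq w v s - qq w v s * qq w v s := by
        rw [Finset.sum_sub_distrib, ← Finset.sum_mul, e1, e2]
    _ ≤ 0 := by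
        have := mul_le_mul_of_nonneg_right h1 (mul_pos q0 q0).le
        linarith

lemma key_compare (hw : ∀ a, 0 < w a) (hw1 : ∑ a, w a = 1) (hv : Function.Injective v)
    (hs : s * s = 1) :
    hn (w5 w) (UU' v s) + hn (w5 w) (XX v s) ≤ hn (w5 w) (UU v s) + hn (w5 w) (XX' v s) := by
  classical
  have k1 := kl_bound w v s hw hw1 (fun y => w y.1) (pw (fun _ => 1) w) (fun y => hw _)
    (fun y => by have := (hw y.1).ne'; simp only [pw]; field_simp) (df_one_le w v s hw hw1 hv)
  have k2 := kl_bound w v s hw hw1 (fun y => w y.2) (pw w (fun _ => 1)) (fun y => hw _)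
    (fun y => by have := (hw y.2).ne'; simp only [pw]; field_simp) (df_one_le' w v s hw hw1 hv hs)
  have : hn (w5 w) (UU' v s) + hn (w5 w) (XX v s) -
      (hn (w5 w) (UU v s) + hn (w5 w) (XX' v s)) ≤
      ∑ x, (if ZZ v s x then w5 w x * Real.log (qq w v s / w x.1.1) else 0) +
      ∑ x, (if ZZ v s x then w5 w x * Real.log (qq w v s / w x.1.2) else 0) := by
    unfold hn
    rw [← Finset.sum_add_distrib, ← Finset.sum_add_distrib, ← Finset.sum_add_distrib,
      ← Finset.sum_sub_distrib]
    refine Finset.sum_le_sum fun x _ => ?_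
    by_cases hx : ZZ v s x
    · have q0 : 0 < qq w v s := by
        rw [← pvX w v s hw1 x hx]
        exact pv_pos _ (w5_pos w hw) _ _
      rw [pvU w v s hw1 x hx, pvX w v s hw1 x hx, pvX' w v s hw1 x hx,
        pvU' w v s hw1 hv hs x hx, if_pos hx, if_pos hx,
        Real.log_div q0.ne' (hw _).ne', Real.log_div q0.ne' (hw _).ne',
        Real.log_mul (mul_pos (hw _) (hw _)).ne' q0.ne', Real.log_mul (hw _).ne' (hw _).ne',
        Real.log_mul q0.ne' q0.ne']
      apply le_of_eq
      ring
    · rw [pvU'_off w v s x hx, if_neg hx, if_neg hx]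
      have h := Real.log_le_log (pv_pos _ (w5_pos w hw) _ _) (pvX'_le w v s hw x)
      have := mul_le_mul_of_nonneg_left h (w5_pos w hw x).le
      linarith
  linarith

lemma core {T : Type*} (hw : ∀ a, 0 < w a) (hw1 : ∑ a, w a = 1) (hv : Function.Injective v)
    (hv0 : ∀ a, v a ≠ 0) (hs : s * s = 1) (V : (S × S) × (S × S) × S → T)
    (hV : ∀ x y, V x = V y → ∃ t : F, t ≠ 0 ∧ v y.1.1 = t * v x.1.1 ∧ v y.1.2 = t * v x.1.2 ∧
      v y.2.1.1 = t * v x.2.1.1 ∧ v y.2.1.2 = t * v x.2.1.2)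
    (hVe : ∀ x y, V x = V y → v x.1.1 = v y.1.1 → v x.2.2 = v y.2.2) :
    hn (w5 w) (XX v s) + hn (w5 w) (fun x => x) ≤ hn (w5 w) (UU v s) + hn (w5 w) V := by
  have h1 := key_compare w v s hw hw1 hv hs
  have hd : ∀ x y, V x = V y → ∃ t : F, t ≠ 0 ∧ v y.1.1 = t * v x.1.1 ∧
      v y.1.2 = t * v x.1.2 ∧ v y.2.1.1 = t * v x.2.1.1 ∧ v y.2.1.2 = t * v x.2.1.2 ∧
      df v s y.1 = t * df v s x.1 ∧ df v s y.2.1 = t * df v s x.2.1 := by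
    intro x y h
    obtain ⟨t, ht, e1, e2, e3, e4⟩ := hV x y h
    refine ⟨t, ht, e1, e2, e3, e4, ?_, ?_⟩
    · simp only [df, e1, e2]; ring
    · simp only [df, e3, e4]; ring
  have h2 := hn_submod (w5 w) (w5_pos w hw) (w5_sum w hw1) (fun x => x) (XX' v s) (UU' v s) V
    ?_ ?_ ?_
  · linarith
  · intro x y hU hVV
    obtain ⟨t, ht, e1, e2, e3, e4, e5, e6⟩ := hd x y hVV
    have ht1 : t = 1 := by
      have hUU : UU v s x = UU v s y := congrArg Prod.fst hU
      simp only [UU, Prod.mk.injEq] at hUU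
      by_cases hx : ZZ v s x
      · have hy : ZZ v s y := ⟨hUU.1.symm.trans hx.1, hUU.2.symm.trans hx.2⟩
        simp only [UU', hx, hy, if_true, Prod.mk.injEq, Option.some.injEq] at hU
        rw [← hU.2] at e1
        exact (mul_eq_right₀ (hv0 x.1.1)).1 e1.symm
      · by_cases h : df v s x.1 = 0
        · have h' : df v s x.2.1 ≠ 0 := fun h' => hx ⟨h, h'⟩
          rw [← hUU.2] at e6
          exact (mul_eq_right₀ h').1 e6.symm
        · rw [← hUU.1] at e5
          exact (mul_eq_right₀ h).1 e5.symm
    subst ht1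
    simp only [one_mul] at e1 e2 e3 e4
    have e0 := hVe x y hVV e1.symm
    exact Prod.ext (Prod.ext (hv e1.symm) (hv e2.symm))
      (Prod.ext (Prod.ext (hv e3.symm) (hv e4.symm)) (hv e0))
  · intro x y hU
    have hUU : UU v s x = UU v s y := congrArg Prod.fst hU
    simp only [UU, Prod.mk.injEq] at hUU
    simp only [XX', XX, ZZ, hUU.1, hUU.2]
  · intro x y hVV
    obtain ⟨t, ht, e1, e2, e3, e4, e5, e6⟩ := hd x y hVV
    simp only [XX', XX, ZZ, e5, e6, ratio_scale t _ _ ht, mul_eq_zero, ht, false_or]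

lemma sl_pair (hw1 : ∑ a, w a = 1) :
    SL (w5 w) (fun x => (x.2.1.1, x.2.1.2)) (w5 w) (fun x => (x.1.1, x.1.2)) ∧
    SL (w5 w) (fun x => (x.1.1, x.2.1.1)) (w5 w) (fun x => (x.1.1, x.1.2)) ∧
    SL (w5 w) (fun x => (x.1.1, x.2.1.2)) (w5 w) (fun x => (x.1.1, x.1.2)) ∧
    SL (w5 w) (fun x => (x.1.1, x.2.2)) (w5 w) (fun x => (x.1.1, x.1.2)) ∧
    SL (w5 w) (fun x => (x.1.2, x.2.2)) (w5 w) (fun x => (x.1.1, x.1.2)) ∧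
    SL (w5 w) (fun x => (x.2.1.1, x.2.2)) (w5 w) (fun x => (x.1.1, x.1.2)) ∧
    SL (w5 w) (fun x => (x.2.1.2, x.2.2)) (w5 w) (fun x => (x.1.1, x.1.2)) ∧
    SL (w5 w) (fun x => (x.1.2, x.1.1)) (w5 w) (fun x => (x.1.1, x.1.2)) := by
  have key : ∀ (E₁ E₂ E₃ E₄ E₅ : S → Prop) (f : (S × S) × (S × S) × S → S × S) (a b : S),
      (∀ x, f x = (a, b) ↔ E₁ x.1.1 ∧ E₂ x.1.2 ∧ E₃ x.2.1.1 ∧ E₄ x.2.1.2 ∧ E₅ x.2.2) →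
      prob (w5 w) {x | f x = (a, b)} = prob w {a | E₁ a} * prob w {a | E₂ a} *
        prob w {a | E₃ a} * prob w {a | E₄ a} * prob w {a | E₅ a} := by
    intro E₁ E₂ E₃ E₄ E₅ f a b h
    rw [← prob5]
    exact prob_congr _ h
  have u := prob_univ' w hw1
  have base : ∀ a b, prob (w5 w) {x | (x.1.1, x.1.2) = (a, b)} = w a * w b := by
    intro a b
    rw [key (· = a) (· = b) (fun _ => True) (fun _ => True) (fun _ => True) _ a b
      (by intro x; simp only [Prod.mk.injEq]; tauto), prob_single, prob_single, u]
    ring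
  refine ⟨?_, ?_, ?_, ?_, ?_, ?_, ?_, ?_⟩ <;> rintro ⟨a, b⟩ <;> rw [base]
  · rw [key (fun _ => True) (fun _ => True) (· = a) (· = b) (fun _ => True) _ a b
      (by intro x; simp only [Prod.mk.injEq]; tauto), prob_single, prob_single, u]; ring
  · rw [key (· = a) (fun _ => True) (· = b) (fun _ => True) (fun _ => True) _ a b
      (by intro x; simp only [Prod.mk.injEq]; tauto), prob_single, prob_single, u]; ring
  · rw [key (· = a) (fun _ => True) (fun _ => True) (· = b) (fun _ => True) _ a b
      (by intro x; simp only [Prod.mk.injEq]; tauto), prob_single, prob_single, u]; ring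
  · rw [key (· = a) (fun _ => True) (fun _ => True) (fun _ => True) (· = b) _ a b
      (by intro x; simp only [Prod.mk.injEq]; tauto), prob_single, prob_single, u]; ring
  · rw [key (fun _ => True) (· = a) (fun _ => True) (fun _ => True) (· = b) _ a b
      (by intro x; simp only [Prod.mk.injEq]; tauto), prob_single, prob_single, u]; ring
  · rw [key (fun _ => True) (fun _ => True) (· = a) (fun _ => True) (· = b) _ a b
      (by intro x; simp only [Prod.mk.injEq]; tauto), prob_single, prob_single, u]; ring
  · rw [key (fun _ => True) (fun _ => True) (fun _ => True) (· = a) (· = b) _ a b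
      (by intro x; simp only [Prod.mk.injEq]; tauto), prob_single, prob_single, u]; ring
  · rw [key (· = b) (· = a) (fun _ => True) (fun _ => True) (fun _ => True) _ a b
      (by intro x; simp [and_comm]), prob_single, prob_single, u]; ring

lemma SL.hn_eq {Ω Ω' S : Type*} [Fintype Ω] [Fintype Ω'] {p : Ω → ℝ} {X : Ω → S}
    {p' : Ω' → ℝ} {X' : Ω' → S} (h : SL p X p' X') : hn p X = hn p' X' := by
  have := h.ent_eq
  rw [ent_eq_hn, ent_eq_hn] at this
  have l : Real.log 2 ≠ 0 := (Real.log_pos (by norm_num)).ne'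
  field_simp at this
  exact this

lemma hn_id (hw : ∀ a, 0 < w a) (hw1 : ∑ a, w a = 1) :
    hn (w5 w) (fun x => x) = 5 * hn (w5 w) (fun x => x.1.1) ∧
    hn (w5 w) (fun x => x.2.2) = hn (w5 w) (fun x => x.1.1) := by
  obtain ⟨s1, s2, s3, s4, s5, s6, s7, s8⟩ := sl_pair w hw1
  have u := prob_univ' w hw1
  have a2 : hn (w5 w) (fun x => x.1.2) = hn (w5 w) (fun x => x.1.1) := (s8.comp Prod.fst).hn_eq
  have a3 : hn (w5 w) (fun x => x.2.1.1) = hn (w5 w) (fun x => x.1.1) := (s1.comp Prod.fst).hn_eq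
  have a4 : hn (w5 w) (fun x => x.2.1.2) = hn (w5 w) (fun x => x.1.1) := (s7.comp Prod.fst).hn_eq
  have a5 : hn (w5 w) (fun x => x.2.2) = hn (w5 w) (fun x => x.1.1) :=
    (s4.comp Prod.snd).hn_eq.trans a2
  refine ⟨?_, a5⟩
  have : hn (w5 w) (fun x => x) = hn (w5 w) (fun x => x.1.1) + hn (w5 w) (fun x => x.1.2) +
      hn (w5 w) (fun x => x.2.1.1) + hn (w5 w) (fun x => x.2.1.2) +
      hn (w5 w) (fun x => x.2.2) := by
    unfold hn
    simp only [← Finset.sum_add_distrib]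
    refine Finset.sum_congr rfl fun x _ => ?_
    have p1 : pv (w5 w) (fun x => x.1.1) x = w x.1.1 := by
      have h := prob5 w (· = x.1.1) (fun _ => True) (fun _ => True) (fun _ => True) (fun _ => True)
      rw [prob_single, u] at h
      simpa [pv] using h
    have p2 : pv (w5 w) (fun x => x.1.2) x = w x.1.2 := by
      have h := prob5 w (fun _ => True) (· = x.1.2) (fun _ => True) (fun _ => True) (fun _ => True)
      rw [prob_single, u] at h
      simpa [pv] using h
    have p3 : pv (w5 w) (fun x => x.2.1.1) x = w x.2.1.1 := by
      have h := prob5 w (fun _ => True) (fun _ => True) (· = x.2.1.1) (fun _ => True)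
        (fun _ => True)
      rw [prob_single, u] at h
      simpa [pv] using h
    have p4 : pv (w5 w) (fun x => x.2.1.2) x = w x.2.1.2 := by
      have h := prob5 w (fun _ => True) (fun _ => True) (fun _ => True) (· = x.2.1.2)
        (fun _ => True)
      rw [prob_single, u] at h
      simpa [pv] using h
    have p5 : pv (w5 w) (fun x => x.2.2) x = w x.2.2 := by
      have h := prob5 w (fun _ => True) (fun _ => True) (fun _ => True) (fun _ => True)
        (· = x.2.2)
      rw [prob_single, u] at h
      simpa [pv] using h
    have p0 : pv (w5 w) (fun x => x) x = w x.1.1 * w x.1.2 * (w x.2.1.1 * w x.2.1.2 * w x.2.2) :=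
      prob_single _ _
    have h1 := (hw x.1.1).ne'
    have h2 := (hw x.1.2).ne'
    have h3 := (hw x.2.1.1).ne'
    have h4 := (hw x.2.1.2).ne'
    have h5 := (hw x.2.2).ne'
    rw [p0, p1, p2, p3, p4, p5, Real.log_mul (by positivity) (by positivity),
      Real.log_mul h1 h2, Real.log_mul (by positivity) h5, Real.log_mul h3 h4]
    ring
  rw [this, a2, a3, a4, a5]
  ring

lemma main5 (hw : ∀ a, 0 < w a) (hw1 : ∑ a, w a = 1) (hv : Function.Injective v)
    (hv0 : ∀ a, v a ≠ 0) (hs : s * s = 1) :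
    hn (w5 w) (XX v s) + 5 * hn (w5 w) (fun x => x.1.1) ≤
      4 * hn (w5 w) (fun x => v x.1.1 * v x.1.2) + 2 * hn (w5 w) (fun x => df v s x.1) ∧
    hn (w5 w) (XX v s) + 4 * hn (w5 w) (fun x => x.1.1) ≤
      3 * hn (w5 w) (fun x => v x.1.1 / v x.1.2) + 2 * hn (w5 w) (fun x => df v s x.1) := by
  obtain ⟨s1, s2, s3, s4, s5, s6, s7, s8⟩ := sl_pair w hw1
  obtain ⟨i1, i2⟩ := hn_id w hw hw1
  have hU : hn (w5 w) (UU v s) ≤ 2 * hn (w5 w) (fun x => df v s x.1) := by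
    have h := hn_pair (w5 w) (w5_pos w hw) (w5_sum w hw1) (fun x => df v s x.1)
      (fun x => df v s x.2.1)
    have h' : hn (w5 w) (fun x => df v s x.2.1) = hn (w5 w) (fun x => df v s x.1) :=
      (s1.comp (df v s)).hn_eq
    have e : hn (w5 w) (UU v s) = hn (w5 w) (fun x => (df v s x.1, df v s x.2.1)) := rfl
    linarith
  constructor
  · have c := core w v s hw hw1 hv hv0 hs
      (fun x => (v x.1.1 * v x.2.2, v x.1.2 * v x.2.2, v x.2.1.1 * v x.2.2,
        v x.2.1.2 * v x.2.2)) ?_ ?_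
    · have g1 := hn_pair (w5 w) (w5_pos w hw) (w5_sum w hw1) (fun x => v x.1.1 * v x.2.2)
        (fun x => (v x.1.2 * v x.2.2, v x.2.1.1 * v x.2.2, v x.2.1.2 * v x.2.2))
      have g2 := hn_pair (w5 w) (w5_pos w hw) (w5_sum w hw1) (fun x => v x.1.2 * v x.2.2)
        (fun x => (v x.2.1.1 * v x.2.2, v x.2.1.2 * v x.2.2))
      have g3 := hn_pair (w5 w) (w5_pos w hw) (w5_sum w hw1) (fun x => v x.2.1.1 * v x.2.2)
        (fun x => v x.2.1.2 * v x.2.2)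
      have l1 := (s4.comp (fun y => v y.1 * v y.2)).hn_eq
      have l2 := (s5.comp (fun y => v y.1 * v y.2)).hn_eq
      have l3 := (s6.comp (fun y => v y.1 * v y.2)).hn_eq
      have l4 := (s7.comp (fun y => v y.1 * v y.2)).hn_eq
      simp only at l1 l2 l3 l4
      linarith
    · intro x y h
      simp only [Prod.mk.injEq] at h
      obtain ⟨h1, h2, h3, h4⟩ := h
      have hy := hv0 y.2.2
      refine ⟨v x.2.2 / v y.2.2, div_ne_zero (hv0 _) hy, ?_, ?_, ?_, ?_⟩ <;> field_simp <;>
        first | linear_combination -h1 | linear_combination -h2 | linear_combination -h3 | linear_combination -h4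
    · intro x y h e
      simp only [Prod.mk.injEq] at h
      have h1 := h.1
      rw [e] at h1
      exact mul_left_cancel₀ (hv0 _) h1
  · have c := core w v s hw hw1 hv hv0 hs
      (fun x => (v x.1.1 / v x.1.2, v x.1.1 / v x.2.1.1, v x.1.1 / v x.2.1.2, x.2.2)) ?_ ?_
    · have g1 := hn_pair (w5 w) (w5_pos w hw) (w5_sum w hw1) (fun x => v x.1.1 / v x.1.2)
        (fun x => (v x.1.1 / v x.2.1.1, v x.1.1 / v x.2.1.2, x.2.2))
      have g2 := hn_pair (w5 w) (w5_pos w hw) (w5_sum w hw1) (fun x => v x.1.1 / v x.2.1.1)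
        (fun x => (v x.1.1 / v x.2.1.2, x.2.2))
      have g3 := hn_pair (w5 w) (w5_pos w hw) (w5_sum w hw1) (fun x => v x.1.1 / v x.2.1.2)
        (fun x => x.2.2)
      have l2 := (s2.comp (fun y => v y.1 / v y.2)).hn_eq
      have l3 := (s3.comp (fun y => v y.1 / v y.2)).hn_eq
      simp only at l2 l3
      linarith
    · intro x y h
      simp only [Prod.mk.injEq] at h
      obtain ⟨h1, h2, h3, h4⟩ := h
      have n1 := hv0 x.1.1
      have n2 := hv0 x.1.2
      have n3 := hv0 x.2.1.1
      have n4 := hv0 x.2.1.2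
      have m1 := hv0 y.1.1
      have m2 := hv0 y.1.2
      have m3 := hv0 y.2.1.1
      have m4 := hv0 y.2.1.2
      rw [div_eq_div_iff (by assumption) (by assumption)] at h1 h2 h3
      refine ⟨v y.1.1 / v x.1.1, div_ne_zero m1 n1, ?_, ?_, ?_, ?_⟩
      · field_simp
      · field_simp; linear_combination h1
      · field_simp; linear_combination h2
      · field_simp; linear_combination h3
    · intro x y h _
      simp only [Prod.mk.injEq] at h
      rw [h.2.2.2]

end core

lemma main_s {Ω F : Type*} [Fintype Ω] [Field F]
    (p : Ω → ℝ) (hp : ∀ ω, 0 ≤ p ω) (hp1 : ∑ ω, p ω = 1) (A B C D : Ω → F)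
    (h0 : prob p {ω | A ω = 0} = 0)
    (hindep : ∀ a b c d : F, prob p {ω | A ω = a ∧ B ω = b ∧ C ω = c ∧ D ω = d} =
      prob p {ω | A ω = a} * prob p {ω | B ω = b} * prob p {ω | C ω = c} *
        prob p {ω | D ω = d})
    (hidB : ∀ r : F, prob p {ω | B ω = r} = prob p {ω | A ω = r})
    (hidC : ∀ r : F, prob p {ω | C ω = r} = prob p {ω | A ω = r})
    (hidD : ∀ r : F, prob p {ω | D ω = r} = prob p {ω | A ω = r}) (s : F) (hs : s * s = 1) :
    (ent p (fun ω => ratio (A ω - s * B ω) (C ω - s * D ω)) + 5 * ent p A ≤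
      4 * ent p (fun ω => A ω * B ω) + 2 * ent p (fun ω => A ω - s * B ω)) ∧
    (ent p (fun ω => ratio (A ω - s * B ω) (C ω - s * D ω)) + 4 * ent p A ≤
      3 * ent p (fun ω => A ω / B ω) + 2 * ent p (fun ω => A ω - s * B ω)) := by
  classical
  let T : Finset F := (Finset.univ.image A).filter fun a => prob p {ω | A ω = a} ≠ 0
  let w : T → ℝ := fun a => prob p {ω | A ω = a}
  let v : T → F := Subtype.val
  have hT : ∀ a, a ∉ T → prob p {ω | A ω = a} = 0 := by
    intro a ha
    by_contra hne
    apply ha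
    refine Finset.mem_filter.2 ⟨?_, hne⟩
    by_contra hni
    apply hne
    refine prob_false _ ?_
    rintro ω rfl
    exact hni (Finset.mem_image_of_mem _ (Finset.mem_univ _))
  have hw : ∀ a, 0 < w a := fun a =>
    lt_of_le_of_ne (prob_nonneg' p hp _) (Finset.mem_filter.1 a.2).2.symm
  have hw1 : ∑ a, w a = 1 := by
    have h := prob_comp p A (fun _ => True) (Finset.univ.image A) (by intro ω; simp)
    rw [prob_univ' p hp1] at h
    rw [h]
    change ∑ a : T, prob p {ω | A ω = (a : F)} = _
    rw [Finset.sum_coe_sort T (fun a => prob p {ω | A ω = a})]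
    simp only [if_true]
    exact Finset.sum_subset (Finset.filter_subset _ _) fun a _ ha => hT a ha
  have hv0 : ∀ a, v a ≠ 0 := by
    rintro ⟨a, ha⟩ h
    have : a = 0 := h
    subst this
    exact (Finset.mem_filter.1 ha).2 h0
  have hv : Function.Injective v := Subtype.val_injective
  have hpr : ∀ a : F, prob w {x | v x = a} = prob p {ω | A ω = a} := by
    intro a
    by_cases ha : a ∈ T
    · have := prob_single w ⟨a, ha⟩
      rw [show prob p {ω | A ω = a} = w ⟨a, ha⟩ from rfl, ← this]
      exact prob_congr _ fun x => ⟨fun h => Subtype.ext h, fun h => by rw [h]⟩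
    · rw [hT a ha]
      refine prob_false _ ?_
      rintro x rfl
      exact ha x.2
  have sl : SL p (fun ω => (A ω, B ω, C ω, D ω)) (w5 w)
      (fun x => (v x.1.1, v x.1.2, v x.2.1.1, v x.2.1.2)) := by
    rintro ⟨a, b, c, d⟩
    have h := prob5 w (fun x => v x = a) (fun x => v x = b) (fun x => v x = c) (fun x => v x = d)
      (fun _ => True)
    rw [prob_univ' w hw1, mul_one, hpr, hpr, hpr, hpr] at h
    have h' := hindep a b c d
    rw [hidB, hidC, hidD, ← h] at h'
    simp only [Prod.mk.injEq]
    rw [h']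
    exact prob_congr _ fun x => by tauto
  have e1 : ent p (fun ω => ratio (A ω - s * B ω) (C ω - s * D ω)) = ent (w5 w) (XX v s) :=
    (sl.comp (fun y => ratio (y.1 - s * y.2.1) (y.2.2.1 - s * y.2.2.2))).ent_eq
  have e2 : ent p A = ent (w5 w) (fun x => x.1.1) := by
    refine (sl.comp (fun y => y.1)).ent_eq.trans ?_
    rw [ent_eq_hn, ent_eq_hn]
    congr 1
    unfold hn
    refine Finset.sum_congr rfl fun x _ => ?_
    have : pv (w5 w) (fun x => v x.1.1) x = pv (w5 w) (fun x => x.1.1) x :=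
      prob_congr _ fun y => hv.eq_iff
    simp only [this]
  have e3 : ent p (fun ω => A ω * B ω) = ent (w5 w) (fun x => v x.1.1 * v x.1.2) :=
    (sl.comp (fun y => y.1 * y.2.1)).ent_eq
  have e4 : ent p (fun ω => A ω / B ω) = ent (w5 w) (fun x => v x.1.1 / v x.1.2) :=
    (sl.comp (fun y => y.1 / y.2.1)).ent_eq
  have e5 : ent p (fun ω => A ω - s * B ω) = ent (w5 w) (fun x => df v s x.1) :=
    (sl.comp (fun y => y.1 - s * y.2.1)).ent_eq
  obtain ⟨m1, m2⟩ := main5 w v s hw hw1 hv hv0 hs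
  rw [e1, e2, e3, e4, e5]
  simp only [ent_eq_hn]
  have l : 0 < Real.log 2 := Real.log_pos (by norm_num)
  constructor
  · have := div_le_div_of_nonneg_right m1 l.le
    rw [add_div, add_div, mul_div_assoc, mul_div_assoc, mul_div_assoc] at this
    exact this
  · have := div_le_div_of_nonneg_right m2 l.le
    rw [add_div, add_div, mul_div_assoc, mul_div_assoc, mul_div_assoc] at this
    exact this

theorem slopes_inequality_iid {Ω F : Type*} [Fintype Ω] [Field F]
    (p : Ω → ℝ) (hp : ∀ ω, 0 ≤ p ω) (hp1 : ∑ ω, p ω = 1) (A B C D : Ω → F)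
    (h0 : prob p {ω | A ω = 0} = 0)
    (hindep : ∀ a b c d : F, prob p {ω | A ω = a ∧ B ω = b ∧ C ω = c ∧ D ω = d} =
      prob p {ω | A ω = a} * prob p {ω | B ω = b} * prob p {ω | C ω = c} *
        prob p {ω | D ω = d})
    (hidB : ∀ r : F, prob p {ω | B ω = r} = prob p {ω | A ω = r})
    (hidC : ∀ r : F, prob p {ω | C ω = r} = prob p {ω | A ω = r})
    (hidD : ∀ r : F, prob p {ω | D ω = r} = prob p {ω | A ω = r}) :
    (ent p (fun ω => ratio (A ω - B ω) (C ω - D ω)) + 5 * ent p A ≤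
      4 * ent p (fun ω => A ω * B ω) + 2 * ent p (fun ω => A ω - B ω)) ∧
    (ent p (fun ω => ratio (A ω + B ω) (C ω + D ω)) + 5 * ent p A ≤
      4 * ent p (fun ω => A ω * B ω) + 2 * ent p (fun ω => A ω + B ω)) ∧
    (ent p (fun ω => ratio (A ω - B ω) (C ω - D ω)) + 4 * ent p A ≤
      3 * ent p (fun ω => A ω / B ω) + 2 * ent p (fun ω => A ω - B ω)) ∧
    (ent p (fun ω => ratio (A ω + B ω) (C ω + D ω)) + 4 * ent p A ≤
      3 * ent p (fun ω => A ω / B ω) + 2 * ent p (fun ω => A ω + B ω)) := by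
  have h1 := main_s p hp hp1 A B C D h0 hindep hidB hidC hidD 1 (by ring)
  have h2 := main_s p hp hp1 A B C D h0 hindep hidB hidC hidD (-1) (by ring)
  simp only [one_mul] at h1
  simp only [neg_mul, one_mul, sub_neg_eq_add] at h2
  exact ⟨h1.1, h2.1, h1.2, h2.2⟩
end
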